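/- Let Y and G be jointly distributed finite-valued random variables. The following are equivalent: (a) there exist random variables W, U, V, Z adjoinable to (Y,G) such that: Y and Z are both uniform with supports of equal cardinality; W is uniform; I(W;Z) = 0; G and U are both uniform with supports of equal cardinality; H(U | (Z,W)) = H((Z,W) | U) = 0; Z and V are both uniform with supports of equal cardinality; and H(U | (Z,V)) = 0; (b) Y and G are uniform over their supports, |supp(Y)| divides |supp(G)|, and |supp(Y)|^2 ≥ |supp(G)|. -/

import Mathlib

namespace CIPaper

/-- A bundled probability space. -/
structure ProbSpace where
  carrier : Type
  [inst : MeasurableSpace carrier]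
  μ : MeasureTheory.Measure carrier
  [isProb : MeasureTheory.IsProbabilityMeasure μ]

attribute [instance] ProbSpace.inst ProbSpace.isProb

/-- A bundled finite measurable alphabet, used as value space of auxiliary random variables. -/
structure FinAlphabet where
  carrier : Type
  [fin : Fintype carrier]
  [ms : MeasurableSpace carrier]
  [msc : MeasurableSingletonClass carrier]

attribute [instance] FinAlphabet.fin FinAlphabet.ms FinAlphabet.msc

open MeasureTheory ProbabilityTheory Real

variable {Ω : Type*} [MeasurableSpace Ω] {S T U : Type*}

/-- P(X = x). -/
noncomputable def pr (μ : Measure Ω) (X : Ω → S) (x : S) : ℝ :=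
  (μ (X ⁻¹' {x})).toReal

/-- Shannon entropy (base 2) of a finite-valued random variable. -/
noncomputable def ent (μ : Measure Ω) [Fintype S] (X : Ω → S) : ℝ :=
  (∑ x, Real.negMulLog (pr μ X x)) / Real.log 2

/-- Conditional entropy H(X|Y). -/
noncomputable def condEnt (μ : Measure Ω) [Fintype S] [Fintype T]
    (X : Ω → S) (Y : Ω → T) : ℝ :=
  ent μ (fun ω => (X ω, Y ω)) - ent μ Y

/-- Mutual information I(X;Y). -/
noncomputable def mi (μ : Measure Ω) [Fintype S] [Fintype T]
    (X : Ω → S) (Y : Ω → T) : ℝ :=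
  ent μ X + ent μ Y - ent μ (fun ω => (X ω, Y ω))

/-- Conditional mutual information I(X;Y|Z). -/
noncomputable def cmi (μ : Measure Ω) [Fintype S] [Fintype T] [Fintype U]
    (X : Ω → S) (Y : Ω → T) (Z : Ω → U) : ℝ :=
  ent μ (fun ω => (X ω, Z ω)) + ent μ (fun ω => (Y ω, Z ω))
    - ent μ (fun ω => (X ω, (Y ω, Z ω))) - ent μ Z

/-- The support of a random variable: values of positive probability. -/
def support (μ : Measure Ω) (X : Ω → S) : Set S := {x | 0 < pr μ X x}

/-- X is uniformly distributed over its support. -/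
def IsUniform (μ : Measure Ω) (X : Ω → S) : Prop :=
  ∀ x ∈ support μ X, ∀ y ∈ support μ X, pr μ X x = pr μ X y

/-- X is uniformly distributed over a support of size n. -/
def UniformOn (μ : Measure Ω) (X : Ω → S) (n : ℕ) : Prop :=
  IsUniform μ X ∧ (support μ X).ncard = n

/-- The TRIPLE predicate: pairwise independence plus each variable a function of the
other two. -/
def TRIPLE (μ : Measure Ω) [Fintype S] [Fintype T] [Fintype U]
    (X : Ω → S) (Y : Ω → T) (Z : Ω → U) : Prop :=
  condEnt μ X (fun ω => (Y ω, Z ω)) = 0 ∧ condEnt μ Y (fun ω => (X ω, Z ω)) = 0 ∧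
    condEnt μ Z (fun ω => (X ω, Y ω)) = 0 ∧
    mi μ X Y = 0 ∧ mi μ X Z = 0 ∧ mi μ Y Z = 0

end CIPaper

namespace CIPaper

open MeasureTheory ProbabilityTheory Real

section Entropy

variable {Ω : Type*} [MeasurableSpace Ω] {S T R : Type*}

lemma pr_nonneg (μ : Measure Ω) (X : Ω → S) (x : S) : 0 ≤ pr μ X x :=
  ENNReal.toReal_nonneg

lemma pr_comp [Fintype S] [DecidableEq T] [MeasurableSpace S] [MeasurableSingletonClass S]
    (μ : Measure Ω) [IsProbabilityMeasure μ] {X : Ω → S} (hX : Measurable X) (f : S → T) (y : T) :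
    pr μ (fun ω => f (X ω)) y = ∑ x with f x = y, pr μ X x := by
  have h := sum_measureReal_preimage_singleton (μ := μ) (f := X)
    (Finset.univ.filter fun x => f x = y) (fun x _ => hX (measurableSet_singleton x))
  refine Eq.trans ?_ h.symm
  change (μ _).toReal = (μ _).toReal
  congr 2
  ext ω
  simp

lemma sum_pr [Fintype S] [MeasurableSpace S] [MeasurableSingletonClass S]
    (μ : Measure Ω) [IsProbabilityMeasure μ] {X : Ω → S} (hX : Measurable X) :
    ∑ x, pr μ X x = 1 := by
  have h := pr_comp μ hX (fun _ => ()) ()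
  simpa [pr] using h.symm

lemma negMulLog_sum_le {ι : Type*} (s : Finset ι) (p : ι → ℝ) (hp : ∀ i, 0 ≤ p i) :
    negMulLog (∑ i ∈ s, p i) ≤ ∑ i ∈ s, negMulLog (p i) := by
  rw [negMulLog, neg_mul, Finset.sum_mul, ← Finset.sum_neg_distrib]
  refine Finset.sum_le_sum fun i hi => ?_
  rcases (hp i).eq_or_lt with h | h
  · simp [← h]
  · have hle : p i ≤ ∑ j ∈ s, p j := Finset.single_le_sum (fun j _ => hp j) hi
    have := mul_le_mul_of_nonneg_left (log_le_log h hle) h.le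
    rw [negMulLog]
    linarith

lemma ent_comp_le [Fintype S] [Fintype T] [MeasurableSpace S] [MeasurableSingletonClass S]
    (μ : Measure Ω) [IsProbabilityMeasure μ] {X : Ω → S} (hX : Measurable X) (f : S → T) :
    ent μ (fun ω => f (X ω)) ≤ ent μ X := by
  classical
  refine div_le_div_of_nonneg_right ?_ (log_nonneg one_le_two)
  rw [← Finset.sum_fiberwise Finset.univ f]
  refine Finset.sum_le_sum fun y _ => ?_
  rw [pr_comp μ hX f y]
  exact negMulLog_sum_le _ _ (pr_nonneg μ X)

lemma ent_comp_eq [Fintype S] [Fintype T] [MeasurableSpace S] [MeasurableSingletonClass S]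
    [MeasurableSpace T] [MeasurableSingletonClass T]
    (μ : Measure Ω) [IsProbabilityMeasure μ] {X : Ω → S} (hX : Measurable X) (f : S → T)
    (g : T → S) (hgf : ∀ x, g (f x) = x) :
    ent μ (fun ω => f (X ω)) = ent μ X := by
  refine le_antisymm (ent_comp_le μ hX f) ?_
  have h := ent_comp_le μ (X := fun ω => f (X ω)) ((Measurable.of_discrete (f := f)).comp hX) g
  simpa [hgf] using h

lemma ncard_support_pos [Fintype S] [MeasurableSpace S] [MeasurableSingletonClass S]
    (μ : Measure Ω) [IsProbabilityMeasure μ] {X : Ω → S} (hX : Measurable X) :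
    0 < (support μ X).ncard := by
  rw [Set.ncard_pos]
  by_contra h
  rw [Set.not_nonempty_iff_eq_empty] at h
  have h0 : ∀ x, pr μ X x = 0 := fun x =>
    le_antisymm (not_lt.1 fun hx => (h ▸ hx : x ∈ (∅ : Set S))) (pr_nonneg μ X x)
  simpa [h0] using sum_pr μ hX

lemma IsUniform.pr_eq [Fintype S] [MeasurableSpace S] [MeasurableSingletonClass S]
    {μ : Measure Ω} [IsProbabilityMeasure μ] {X : Ω → S} (hX : Measurable X)
    (h : IsUniform μ X) {x : S} (hx : x ∈ support μ X) :
    pr μ X x = ((support μ X).ncard : ℝ)⁻¹ := by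
  classical
  have hsum : ∑ y ∈ (support μ X).toFinset, pr μ X y = 1 := by
    rw [← sum_pr μ hX]
    refine Finset.sum_subset (Finset.subset_univ _) fun y _ hy => ?_
    rw [Set.mem_toFinset] at hy
    exact le_antisymm (not_lt.1 hy) (pr_nonneg μ X y)
  rw [Finset.sum_congr rfl fun y hy => h y (Set.mem_toFinset.1 hy) x hx, Finset.sum_const,
    nsmul_eq_mul, ← Set.ncard_eq_toFinset_card'] at hsum
  exact eq_inv_of_mul_eq_one_right hsum

lemma IsUniform.ent_eq [Fintype S] [MeasurableSpace S] [MeasurableSingletonClass S]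
    {μ : Measure Ω} [IsProbabilityMeasure μ] {X : Ω → S} (hX : Measurable X)
    (h : IsUniform μ X) :
    ent μ X = log (support μ X).ncard / log 2 := by
  rw [ent]
  congr 1
  have hterm : ∀ x, negMulLog (pr μ X x) = pr μ X x * log (support μ X).ncard := by
    intro x
    rcases (pr_nonneg μ X x).eq_or_lt with h0 | h0
    · simp [← h0]
    · rw [negMulLog, h.pr_eq hX h0, log_inv]
      ring
  rw [Finset.sum_congr rfl fun x _ => hterm x, ← Finset.sum_mul, sum_pr μ hX, one_mul]

lemma ent_le_log_ncard [Fintype S] [MeasurableSpace S] [MeasurableSingletonClass S]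
    (μ : Measure Ω) [IsProbabilityMeasure μ] {X : Ω → S} (hX : Measurable X) :
    ent μ X ≤ log (support μ X).ncard / log 2 := by
  classical
  refine div_le_div_of_nonneg_right ?_ (log_nonneg one_le_two)
  have hN : (0 : ℝ) < (support μ X).ncard := by exact_mod_cast ncard_support_pos μ hX
  set N : ℝ := ((support μ X).ncard : ℝ) with hNdef
  have hterm : ∀ x, negMulLog (pr μ X x) ≤
      pr μ X x * log N + ((if x ∈ support μ X then N⁻¹ else 0) - pr μ X x) := by
    intro x
    rcases (pr_nonneg μ X x).eq_or_lt with h0 | h0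
    · rw [← h0]
      simp only [negMulLog_zero, zero_mul, zero_add, sub_zero]
      split_ifs <;> positivity
    · have hx : x ∈ support μ X := h0
      have hl := log_le_sub_one_of_pos (x := (pr μ X x * N)⁻¹) (by positivity)
      rw [log_inv, log_mul h0.ne' hN.ne'] at hl
      have := mul_le_mul_of_nonneg_left hl h0.le
      have he : pr μ X x * ((pr μ X x * N)⁻¹ - 1) = N⁻¹ - pr μ X x := by field_simp
      rw [if_pos hx, negMulLog, ← he]
      linarith
  refine (Finset.sum_le_sum fun x _ => hterm x).trans ?_
  rw [Finset.sum_add_distrib, Finset.sum_sub_distrib, ← Finset.sum_mul, sum_pr μ hX, one_mul,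
    ← Finset.sum_filter, Finset.sum_const, nsmul_eq_mul]
  have hc : ((Finset.univ.filter fun x => x ∈ support μ X).card : ℝ) = N := by
    rw [hNdef, Set.ncard_eq_toFinset_card']
    congr 2
    ext x
    simp
  rw [hc, mul_inv_cancel₀ hN.ne']
  simp

lemma ncard_support_prod_le [Fintype S] [Fintype T] (μ : Measure Ω) [IsProbabilityMeasure μ]
    (X : Ω → S) (Y : Ω → T) :
    (support μ fun ω => (X ω, Y ω)).ncard ≤ (support μ X).ncard * (support μ Y).ncard := by
  rw [← Set.ncard_prod]
  refine Set.ncard_le_ncard (fun p hp => ⟨?_, ?_⟩)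
  · exact lt_of_lt_of_le hp (ENNReal.toReal_mono (measure_ne_top _ _)
      (measure_mono fun ω hω => congrArg Prod.fst hω))
  · exact lt_of_lt_of_le hp (ENNReal.toReal_mono (measure_ne_top _ _)
      (measure_mono fun ω hω => congrArg Prod.snd hω))

lemma support_eq_univ_of_pr_const [Fintype S] [MeasurableSpace S] [MeasurableSingletonClass S]
    (μ : Measure Ω) [IsProbabilityMeasure μ] {X : Ω → S} (hX : Measurable X)
    (h : ∀ x y, pr μ X x = pr μ X y) : support μ X = Set.univ := by
  obtain ⟨x, hx⟩ := (Set.ncard_pos).1 (ncard_support_pos μ hX)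
  exact Set.eq_univ_of_forall fun y => lt_of_lt_of_eq hx (h x y)

lemma ncard_support_of_pr_const [Fintype S] [MeasurableSpace S] [MeasurableSingletonClass S]
    (μ : Measure Ω) [IsProbabilityMeasure μ] {X : Ω → S} (hX : Measurable X)
    (h : ∀ x y, pr μ X x = pr μ X y) : (support μ X).ncard = Fintype.card S := by
  rw [support_eq_univ_of_pr_const μ hX h, Set.ncard_univ, Nat.card_eq_fintype_card]

lemma isUniform_congr {Ω' : Type*} [MeasurableSpace Ω'] {μ : Measure Ω} {μ' : Measure Ω'}
    {X : Ω → S} {X' : Ω' → S} (h : pr μ X = pr μ' X') : IsUniform μ X ↔ IsUniform μ' X' := by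
  simp only [IsUniform, support, h]

lemma support_congr {Ω' : Type*} [MeasurableSpace Ω'] {μ : Measure Ω} {μ' : Measure Ω'}
    {X : Ω → S} {X' : Ω' → S} (h : pr μ X = pr μ' X') : support μ X = support μ' X' := by
  simp only [support, h]

lemma pr_eq_of_identDistrib {Ω' : Type*} [MeasurableSpace Ω'] [MeasurableSpace S]
    [MeasurableSingletonClass S] {μ : Measure Ω} {μ' : Measure Ω'}
    {X : Ω → S} {X' : Ω' → S} (h : IdentDistrib X X' μ μ') : pr μ X = pr μ' X' := by
  ext x
  exact congrArg ENNReal.toReal (h.measure_mem_eq (measurableSet_singleton x))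

/-- The size of a uniform variable `U` equivalent to a pair of independent uniform variables is
the product of their sizes. -/
lemma ncard_support_eq_mul [Fintype S] [MeasurableSpace S] [MeasurableSingletonClass S]
    [Fintype T] [MeasurableSpace T] [MeasurableSingletonClass T]
    [Fintype R] [MeasurableSpace R] [MeasurableSingletonClass R]
    (μ : Measure Ω) [IsProbabilityMeasure μ] {U : Ω → S} {Z : Ω → T} {W : Ω → R}
    (hU : Measurable U) (hZ : Measurable Z) (hW : Measurable W)
    (uU : IsUniform μ U) (uZ : IsUniform μ Z) (uW : IsUniform μ W) (hI : mi μ W Z = 0)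
    (h₁ : condEnt μ U (fun ω => (Z ω, W ω)) = 0) (h₂ : condEnt μ (fun ω => (Z ω, W ω)) U = 0) :
    (support μ U).ncard = (support μ Z).ncard * (support μ W).ncard := by
  have e₁ : ent μ (fun ω => (U ω, (Z ω, W ω))) = ent μ (fun ω => ((Z ω, W ω), U ω)) :=
    ent_comp_eq μ (X := fun ω => ((Z ω, W ω), U ω)) ((hZ.prodMk hW).prodMk hU) Prod.swap
      Prod.swap Prod.swap_swap
  have e₂ : ent μ (fun ω => (W ω, Z ω)) = ent μ (fun ω => (Z ω, W ω)) :=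
    ent_comp_eq μ (X := fun ω => (Z ω, W ω)) (hZ.prodMk hW) Prod.swap Prod.swap Prod.swap_swap
  rw [condEnt] at h₁ h₂
  rw [mi] at hI
  have e : ent μ U = ent μ Z + ent μ W := by linarith
  have pU := ncard_support_pos μ hU
  have pZ := ncard_support_pos μ hZ
  have pW := ncard_support_pos μ hW
  rw [uU.ent_eq hU, uZ.ent_eq hZ, uW.ent_eq hW, ← add_div,
    div_left_inj' (log_pos one_lt_two).ne', ← log_mul (by positivity) (by positivity)] at e
  have := log_injOn_pos (Set.mem_Ioi.2 (by positivity)) (Set.mem_Ioi.2 (by positivity)) e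
  exact_mod_cast this

lemma ncard_support_le_mul [Fintype S] [MeasurableSpace S] [MeasurableSingletonClass S]
    [Fintype T] [MeasurableSpace T] [MeasurableSingletonClass T]
    [Fintype R] [MeasurableSpace R] [MeasurableSingletonClass R]
    (μ : Measure Ω) [IsProbabilityMeasure μ] {U : Ω → S} {Z : Ω → T} {V : Ω → R}
    (hU : Measurable U) (hZ : Measurable Z) (hV : Measurable V)
    (uU : IsUniform μ U) (h : condEnt μ U (fun ω => (Z ω, V ω)) = 0) :
    (support μ U).ncard ≤ (support μ Z).ncard * (support μ V).ncard := by
  have e₁ : ent μ U ≤ ent μ (fun ω => (U ω, (Z ω, V ω))) :=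
    ent_comp_le μ (X := fun ω => (U ω, (Z ω, V ω))) (hU.prodMk (hZ.prodMk hV)) Prod.fst
  have e₂ := ent_le_log_ncard μ (hZ.prodMk hV)
  rw [condEnt] at h
  have e : ent μ U ≤ log (support μ fun ω => (Z ω, V ω)).ncard / log 2 := by linarith
  have pU := ncard_support_pos μ hU
  have pZV := ncard_support_pos μ (hZ.prodMk hV)
  rw [uU.ent_eq hU, div_le_div_iff_of_pos_right (log_pos one_lt_two),
    log_le_log_iff (by positivity) (by positivity)] at e
  exact le_trans (by exact_mod_cast e) (ncard_support_prod_le μ Z V)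

end Entropy

section Construction

lemma pr_prod_uniform_const {A B T : Type*} [MeasurableSpace A] (ν : Measure A)
    [IsProbabilityMeasure ν] [Fintype B] [Nonempty B] [MeasurableSpace B]
    [MeasurableSingletonClass B] (g : B → T) (x y : T) (σ : B ≃ B)
    (hσ : ∀ b, g b = x ↔ g (σ b) = y) :
    pr (ν.prod (uniformOn (Set.univ : Set B))) (fun ω => g ω.2) x =
      pr (ν.prod (uniformOn (Set.univ : Set B))) (fun ω => g ω.2) y := by
  have : IsProbabilityMeasure (uniformOn (Set.univ : Set B)) :=
    isProbabilityMeasure_uniformOn Set.finite_univ Set.univ_nonempty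
  have key : ∀ t, pr (ν.prod (uniformOn (Set.univ : Set B))) (fun ω => g ω.2) t =
      (uniformOn (Set.univ : Set B) (g ⁻¹' {t})).toReal := fun t =>
    congrArg ENNReal.toReal (measurePreserving_snd.measure_preimage
      (Set.toFinite (g ⁻¹' {t})).measurableSet.nullMeasurableSet)
  rw [key, key, uniformOn_univ, uniformOn_univ, Measure.count_apply (Set.toFinite _).measurableSet,
    Measure.count_apply (Set.toFinite _).measurableSet]
  congr 3
  exact Set.encard_congr (σ.subtypeEquiv hσ)

lemma injective_fst_add_castLE {n m : ℕ} [NeZero n] (hmn : m ≤ n) :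
    Function.Injective (fun u : Fin n × Fin m => (u.1, u.1 + Fin.castLE hmn u.2)) := by
  rintro ⟨a, b⟩ ⟨c, d⟩ h
  simp only [Prod.mk.injEq] at h
  obtain ⟨rfl, h⟩ := h
  rw [Fin.castLE_injective hmn (add_left_cancel h)]

end Construction

/-- the GESQRT characterization. -/
theorem stmt_14 {Ω : Type*} [MeasurableSpace Ω] (μ : Measure Ω) [IsProbabilityMeasure μ]
    {SY SG : Type*} [Fintype SY] [Fintype SG]
    [MeasurableSpace SY] [MeasurableSingletonClass SY]
    [MeasurableSpace SG] [MeasurableSingletonClass SG]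
    (Y : Ω → SY) (G : Ω → SG) (hY : Measurable Y) (hG : Measurable G) :
    (∃ (P : ProbSpace) (Y' : P.carrier → SY) (G' : P.carrier → SG)
      (TW TU TV TZ : FinAlphabet)
      (W : P.carrier → TW.carrier) (U : P.carrier → TU.carrier)
      (V : P.carrier → TV.carrier) (Z : P.carrier → TZ.carrier),
      Measurable Y' ∧ Measurable G' ∧ Measurable W ∧ Measurable U ∧
      Measurable V ∧ Measurable Z ∧
      IdentDistrib (fun ω => (Y ω, G ω)) (fun ω => (Y' ω, G' ω)) μ P.μ ∧
      IsUniform P.μ Y' ∧ IsUniform P.μ Z ∧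
      (support P.μ Y').ncard = (support P.μ Z).ncard ∧
      IsUniform P.μ W ∧ mi P.μ W Z = 0 ∧
      IsUniform P.μ G' ∧ IsUniform P.μ U ∧
      (support P.μ G').ncard = (support P.μ U).ncard ∧
      condEnt P.μ U (fun ω => (Z ω, W ω)) = 0 ∧
      condEnt P.μ (fun ω => (Z ω, W ω)) U = 0 ∧
      IsUniform P.μ V ∧ (support P.μ Z).ncard = (support P.μ V).ncard ∧
      condEnt P.μ U (fun ω => (Z ω, V ω)) = 0) ↔
    (IsUniform μ Y ∧ IsUniform μ G ∧
      (support μ Y).ncard ∣ (support μ G).ncard ∧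
      (support μ G).ncard ≤ (support μ Y).ncard ^ 2) := by
  constructor
  · rintro ⟨P, Y', G', TW, TU, TV, TZ, W, U, V, Z, hY', hG', hW, hU, hV, hZ, hid, uY, uZ, cYZ, uW,
      hI, uG, uU, cGU, h₁, h₂, uV, cZV, h₃⟩
    have pY : pr μ Y = pr P.μ Y' := pr_eq_of_identDistrib (hid.comp measurable_fst)
    have pG : pr μ G = pr P.μ G' := pr_eq_of_identDistrib (hid.comp measurable_snd)
    refine ⟨(isUniform_congr pY).2 uY, (isUniform_congr pG).2 uG, ?_, ?_⟩
    · rw [support_congr pY, support_congr pG, cGU, cYZ,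
        ncard_support_eq_mul P.μ hU hZ hW uU uZ uW hI h₁ h₂]
      exact dvd_mul_right _ _
    · have h := ncard_support_le_mul P.μ hU hZ hV uU h₃
      rw [← cZV, ← sq] at h
      rwa [support_congr pY, support_congr pG, cGU, cYZ]
  · rintro ⟨uY, uG, ⟨m, hm⟩, hle⟩
    have pY := ncard_support_pos μ hY
    have pG := ncard_support_pos μ hG
    generalize hn : (support μ Y).ncard = n at *
    have hmn : m ≤ n := by
      rw [hm, sq] at hle
      exact Nat.le_of_mul_le_mul_left hle pY
    have hm0 : 0 < m := by
      rw [hm] at pG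
      exact Nat.pos_of_mul_pos_left pG
    have : NeZero n := ⟨pY.ne'⟩
    have : NeZero m := ⟨hm0.ne'⟩
    let eY := Fintype.equivFin SY
    let eG := Fintype.equivFin SG
    let ν : Measure (Fin (Fintype.card SY) × Fin (Fintype.card SG)) :=
      μ.map (fun ω => (eY (Y ω), eG (G ω)))
    have hmeas : Measurable (fun ω => (eY (Y ω), eG (G ω))) :=
      (Measurable.of_discrete.comp hY).prodMk (Measurable.of_discrete.comp hG)
    have : IsProbabilityMeasure ν := Measure.isProbabilityMeasure_map hmeas.aemeasurable
    let κ : Measure (Fin n × Fin m) := uniformOn Set.univ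
    have : IsProbabilityMeasure κ :=
      isProbabilityMeasure_uniformOn Set.finite_univ Set.univ_nonempty
    let μ' := ν.prod κ
    let Y' : (Fin (Fintype.card SY) × Fin (Fintype.card SG)) × (Fin n × Fin m) → SY :=
      fun ω => eY.symm ω.1.1
    let G' : (Fin (Fintype.card SY) × Fin (Fintype.card SG)) × (Fin n × Fin m) → SG :=
      fun ω => eG.symm ω.1.2
    let U : (Fin (Fintype.card SY) × Fin (Fintype.card SG)) × (Fin n × Fin m) → Fin n × Fin m :=
      fun ω => ω.2
    let Z : (Fin (Fintype.card SY) × Fin (Fintype.card SG)) × (Fin n × Fin m) → Fin n :=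
      fun ω => ω.2.1
    let W : (Fin (Fintype.card SY) × Fin (Fintype.card SG)) × (Fin n × Fin m) → Fin m :=
      fun ω => ω.2.2
    let V : (Fin (Fintype.card SY) × Fin (Fintype.card SG)) × (Fin n × Fin m) → Fin n :=
      fun ω => ω.2.1 + Fin.castLE hmn ω.2.2
    have mY' : Measurable Y' := Measurable.of_discrete
    have mG' : Measurable G' := Measurable.of_discrete
    have mU : Measurable U := Measurable.of_discrete
    have mZ : Measurable Z := Measurable.of_discrete
    have mW : Measurable W := Measurable.of_discrete
    have mV : Measurable V := Measurable.of_discrete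
    have hid : IdentDistrib (fun ω => (Y ω, G ω)) (fun ω => (Y' ω, G' ω)) μ μ' := by
      refine ⟨(hY.prodMk hG).aemeasurable, (mY'.prodMk mG').aemeasurable, ?_⟩
      let d : Fin (Fintype.card SY) × Fin (Fintype.card SG) → SY × SG :=
        fun p => (eY.symm p.1, eG.symm p.2)
      have hd : Measurable d := Measurable.of_discrete
      have e₁ : μ'.map (fun ω => (Y' ω, G' ω)) = (μ'.map Prod.fst).map d :=
        (Measure.map_map hd measurable_fst).symm
      rw [e₁, measurePreserving_fst.map_eq, Measure.map_map hd hmeas]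
      congr 1
      ext ω <;> simp [d]
    have qY : pr μ Y = pr μ' Y' := pr_eq_of_identDistrib (hid.comp measurable_fst)
    have qG : pr μ G = pr μ' G' := pr_eq_of_identDistrib (hid.comp measurable_snd)
    have cU : ∀ x y, pr μ' U x = pr μ' U y := fun x y =>
      pr_prod_uniform_const ν (fun b => b) x y (Equiv.swap x y) fun b => by
        rw [Equiv.swap_apply_eq_iff, Equiv.swap_apply_right]
    have cZ : ∀ x y, pr μ' Z x = pr μ' Z y := fun x y =>
      pr_prod_uniform_const ν (fun b : Fin n × Fin m => b.1) x y
        ((Equiv.swap x y).prodCongr (Equiv.refl _)) fun b => by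
          simp [Equiv.swap_apply_eq_iff]
    have cW : ∀ x y, pr μ' W x = pr μ' W y := fun x y =>
      pr_prod_uniform_const ν (fun b : Fin n × Fin m => b.2) x y
        ((Equiv.refl _).prodCongr (Equiv.swap x y)) fun b => by
          simp [Equiv.swap_apply_eq_iff]
    have cV : ∀ x y, pr μ' V x = pr μ' V y := fun x y =>
      pr_prod_uniform_const ν (fun b : Fin n × Fin m => b.1 + Fin.castLE hmn b.2) x y
        ((Equiv.addRight (y - x)).prodCongr (Equiv.refl _)) fun b => by
          simp only [Equiv.prodCongr_apply, Prod.map, Equiv.coe_addRight, Equiv.refl_apply]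
          rw [add_right_comm, ← add_sub_assoc, sub_eq_iff_eq_add, add_comm y x, add_left_inj]
    have uU : IsUniform μ' U := fun x _ y _ => cU x y
    have uZ : IsUniform μ' Z := fun x _ y _ => cZ x y
    have uW : IsUniform μ' W := fun x _ y _ => cW x y
    have nU := ncard_support_of_pr_const μ' mU cU
    have nZ := ncard_support_of_pr_const μ' mZ cZ
    have nW := ncard_support_of_pr_const μ' mW cW
    have nV := ncard_support_of_pr_const μ' mV cV
    rw [Fintype.card_prod, Fintype.card_fin, Fintype.card_fin] at nU
    rw [Fintype.card_fin] at nZ nW nV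
    refine ⟨⟨_, μ'⟩, Y', G', ⟨Fin m⟩, ⟨Fin n × Fin m⟩, ⟨Fin n⟩, ⟨Fin n⟩, W, U, V, Z,
      mY', mG', mW, mU, mV, mZ, hid, (isUniform_congr qY).1 uY, uZ, ?_, uW, ?_,
      (isUniform_congr qG).1 uG, uU, ?_, ?_, ?_, fun x _ y _ => cV x y, nZ.trans nV.symm, ?_⟩
    · exact (support_congr qY ▸ hn).trans nZ.symm
    · have e : ent μ' (fun ω => (W ω, Z ω)) = ent μ' U :=
        ent_comp_eq μ' mU Prod.swap Prod.swap Prod.swap_swap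
      change ent μ' W + ent μ' Z - ent μ' (fun ω => (W ω, Z ω)) = 0
      rw [e, uU.ent_eq mU, uW.ent_eq mW, uZ.ent_eq mZ, nU, nZ, nW, Nat.cast_mul,
        log_mul (by exact_mod_cast pY.ne') (by exact_mod_cast hm0.ne')]
      ring
    · exact (support_congr qG ▸ hm).trans nU.symm
    · exact sub_eq_zero.2 (ent_comp_eq μ' mU (fun u => (u, u)) Prod.fst fun _ => rfl)
    · exact sub_eq_zero.2 (ent_comp_eq μ' mU (fun u => (u, u)) Prod.fst fun _ => rfl)
    · have e₁ : ent μ' (fun ω => (U ω, (Z ω, V ω))) = ent μ' U :=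
        ent_comp_eq μ' mU (fun u => (u, (u.1, u.1 + Fin.castLE hmn u.2))) Prod.fst fun _ => rfl
      have e₂ : ent μ' (fun ω => (Z ω, V ω)) = ent μ' U :=
        ent_comp_eq μ' mU (fun u => (u.1, u.1 + Fin.castLE hmn u.2)) (Function.invFun _)
          (Function.leftInverse_invFun (injective_fst_add_castLE hmn))
      exact sub_eq_zero.2 (e₁.trans e₂.symm)

end CIPaper
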